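/- Let n ≥ 4 be an even natural number, let t_min > 0 and λ > 0 be reals with λ·t_min ≤ ln 12, and let μ be the truncated Exponential distribution on [t_min, ∞), i.e., the Borel probability measure on ℝ with μ((−∞, t]) = 1 − e^{−λt} for t ≥ t_min and μ((−∞, t]) = 0 for t < t_min. Assume the worst-case guarantee that SC_M(t) ≤ ((n + 1)/2)·minᵢ tᵢ for every t : Fin n → ℝ with all coordinates ≥ t_min. Then ∫ (SC_M(t) / minᵢ tᵢ) dμⁿ(t) < 2·(ln 12)/(λ·t_min) + 1.33. -/

import Mathlib

open MeasureTheory Finset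
open scoped ENNReal

/-- The expected social cost of Koutsoupias's truthful scheduling mechanism on a
nondecreasingly sorted input `s` (index `⟨0, hn⟩` plays the role of machine 1). -/
noncomputable def SCM {n : ℕ} (s : Fin n → ℝ) (hn : 0 < n) : ℝ :=
  (∫ y in (0:ℝ)..(s ⟨0, hn⟩),
      ∏ i ∈ Finset.univ.filter (fun i => i ≠ (⟨0, hn⟩ : Fin n)), (1 - y / s i)) +
  ∑ k ∈ Finset.univ.filter (fun k => k ≠ (⟨0, hn⟩ : Fin n)),
    (1 / s ⟨0, hn⟩) *
      ∫ y in (0:ℝ)..(s ⟨0, hn⟩), ∫ x in (0:ℝ)..y,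
        ∏ i ∈ Finset.univ.filter (fun i => i ≠ (⟨0, hn⟩ : Fin n) ∧ i ≠ k), (1 - x / s i)

/-- The expected social cost of the mechanism on a general input `t`: apply `SCM`
to the nondecreasing rearrangement of `t`. -/
noncomputable def SCMgen {n : ℕ} (t : Fin n → ℝ) (hn : 0 < n) : ℝ :=
  SCM (t ∘ Tuple.sort t) hn

/-- If every `s i` is at least `x ≥ 0` and at least `p` of the `s i` with `i ∈ A` are at most `τ`,
then the product of the factors `1 - x / s i` over `A` is at most `(1 - x / τ) ^ p`. -/
lemma prod_one_sub_div_le_pow {ι : Type*} {s : ι → ℝ} {τ x : ℝ} (hs : ∀ i, 0 < s i)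
    (hx : 0 ≤ x) (hxs : ∀ i, x ≤ s i) (hxτ : x ≤ τ) (A : Finset ι) {p : ℕ}
    (hp : p ≤ #{i ∈ A | s i ≤ τ}) :
    ∏ i ∈ A, (1 - x / s i) ≤ (1 - x / τ) ^ p := by
  have h0 : ∀ i, 0 ≤ 1 - x / s i := fun i ↦
    sub_nonneg.2 ((div_le_one (hs i)).2 (hxs i))
  have h1 : ∀ i, 1 - x / s i ≤ 1 := fun i ↦ sub_le_self _ (div_nonneg hx (hs i).le)
  have hτ0 : 0 ≤ 1 - x / τ := sub_nonneg.2 (div_le_one_of_le₀ hxτ (hx.trans hxτ))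
  have hτ1 : 1 - x / τ ≤ 1 := sub_le_self _ (div_nonneg hx (hx.trans hxτ))
  calc ∏ i ∈ A, (1 - x / s i)
      ≤ ∏ i ∈ A with s i ≤ τ, (1 - x / s i) :=
        Finset.prod_le_prod_of_subset_of_le_one (Finset.filter_subset _ _)
          (fun i _ ↦ h0 i) (fun i _ _ ↦ h1 i)
    _ ≤ ∏ i ∈ A with s i ≤ τ, (1 - x / τ) := by
        refine Finset.prod_le_prod (fun i _ ↦ h0 i) fun i hi ↦ ?_
        have := div_le_div_of_nonneg_left hx (hs i) (Finset.mem_filter.1 hi).2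
        linarith
    _ = (1 - x / τ) ^ #{i ∈ A | s i ≤ τ} := Finset.prod_const _
    _ ≤ (1 - x / τ) ^ p := pow_le_pow_of_le_one hτ0 hτ1 hp

lemma integral_one_sub_div_pow_le {τ y : ℝ} (hτ : 0 < τ) (hyτ : y ≤ τ) (p : ℕ) :
    ∫ x in (0:ℝ)..y, (1 - x / τ) ^ p ≤ τ / (p + 1) := by
  have hd : ∀ x ∈ Set.uIcc 0 y,
      HasDerivAt (fun x ↦ -(τ / (p + 1)) * (1 - x / τ) ^ (p + 1)) ((1 - x / τ) ^ p) x := by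
    intro x _
    have h := ((((hasDerivAt_id x).div_const τ).const_sub 1).pow (p + 1)).const_mul
      (-(τ / ((p : ℝ) + 1)))
    refine h.congr_deriv ?_
    have : (p : ℝ) + 1 ≠ 0 := by positivity
    simp only [id, Nat.add_sub_cancel]
    push_cast
    field_simp
  rw [intervalIntegral.integral_eq_sub_of_hasDerivAt hd
    (Continuous.intervalIntegrable (by fun_prop) _ _)]
  have h0 : 0 ≤ 1 - y / τ := sub_nonneg.2 (div_le_one_of_le₀ hyτ hτ.le)
  have : 0 ≤ τ / (p + 1) * (1 - y / τ) ^ (p + 1) := by positivity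
  simp only [zero_div, sub_zero, one_pow]
  linarith

lemma integral_prod_one_sub_div_le {ι : Type*} {s : ι → ℝ} {τ y : ℝ} (hs : ∀ i, 0 < s i)
    (hy : 0 ≤ y) (hys : ∀ i, y ≤ s i) (hτ : 0 < τ) (hyτ : y ≤ τ) (A : Finset ι) {p : ℕ}
    (hp : p ≤ #{i ∈ A | s i ≤ τ}) :
    ∫ x in (0:ℝ)..y, ∏ i ∈ A, (1 - x / s i) ≤ τ / (p + 1) :=
  (intervalIntegral.integral_mono_on hy
    (Continuous.intervalIntegrable (by fun_prop) _ _)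
    (Continuous.intervalIntegrable (by fun_prop) _ _) fun x hx ↦
      prod_one_sub_div_le_pow hs hx.1 (fun i ↦ hx.2.trans (hys i)) (hx.2.trans hyτ) A hp).trans
    (integral_one_sub_div_pow_le hτ hyτ p)

lemma integral_prod_one_sub_div_nonneg {ι : Type*} {s : ι → ℝ} {y : ℝ} (hs : ∀ i, 0 < s i)
    (hy : 0 ≤ y) (hys : ∀ i, y ≤ s i) (A : Finset ι) :
    0 ≤ ∫ x in (0:ℝ)..y, ∏ i ∈ A, (1 - x / s i) :=
  intervalIntegral.integral_nonneg hy fun _ hx ↦ Finset.prod_nonneg fun i _ ↦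
    sub_nonneg.2 ((div_le_one (hs i)).2 (hx.2.trans (hys i)))

section SCM

variable {n : ℕ} {s : Fin n → ℝ} (hn : 0 < n)

lemma SCM_nonneg (hs : ∀ i, 0 < s i) (hmin : ∀ i, s ⟨0, hn⟩ ≤ s i) : 0 ≤ SCM s hn := by
  refine add_nonneg (integral_prod_one_sub_div_nonneg hs (hs _).le hmin _)
    (Finset.sum_nonneg fun k _ ↦ mul_nonneg (one_div_nonneg.2 (hs _).le) ?_)
  exact intervalIntegral.integral_nonneg (hs _).le fun y hy ↦
    integral_prod_one_sub_div_nonneg hs hy.1 (fun i ↦ hy.2.trans (hmin i)) _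

/-- If at least `p + 2` machines have processing time at most `τ`, the social cost of the
mechanism is at most `τ / (p + 2) + (n - 1) * (τ / (p + 1))`. -/
lemma SCM_le (hs : ∀ i, 0 < s i) (hmin : ∀ i, s ⟨0, hn⟩ ≤ s i) {τ : ℝ} {p : ℕ}
    (hp : p + 2 ≤ #{i | s i ≤ τ}) :
    SCM s hn ≤ τ / (p + 2) + (n - 1) * (τ / (p + 1)) := by
  obtain ⟨j, hj⟩ := Finset.card_pos.1 (by omega : 0 < #{i | s i ≤ τ})
  have h0τ : s ⟨0, hn⟩ ≤ τ := (hmin j).trans (Finset.mem_filter.1 hj).2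
  have hτ : 0 < τ := (hs _).trans_le h0τ
  have hcard₁ : p + 1 ≤ #{i ∈ univ.filter (fun i => i ≠ (⟨0, hn⟩ : Fin n)) | s i ≤ τ} := by
    have : ({i ∈ univ.filter (fun i => i ≠ (⟨0, hn⟩ : Fin n)) | s i ≤ τ} : Finset (Fin n))
        = ({i | s i ≤ τ} : Finset (Fin n)).erase ⟨0, hn⟩ := by
      ext i; simp
    rw [this]
    have := Finset.pred_card_le_card_erase (s := ({i | s i ≤ τ} : Finset (Fin n)))
      (a := ⟨0, hn⟩)
    omega
  have hcard₂ : ∀ k,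
      p ≤ #{i ∈ univ.filter (fun i => i ≠ (⟨0, hn⟩ : Fin n) ∧ i ≠ k) | s i ≤ τ} := by
    intro k
    have : ({i ∈ univ.filter (fun i => i ≠ (⟨0, hn⟩ : Fin n) ∧ i ≠ k) | s i ≤ τ} :
        Finset (Fin n))
        = ({i ∈ univ.filter (fun i => i ≠ (⟨0, hn⟩ : Fin n)) | s i ≤ τ}).erase k := by
      ext i; simp; tauto
    rw [this]
    have := Finset.pred_card_le_card_erase
      (s := ({i ∈ univ.filter (fun i => i ≠ (⟨0, hn⟩ : Fin n)) | s i ≤ τ})) (a := k)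
    omega
  have hterm : ∀ k, (1 / s ⟨0, hn⟩) *
      ∫ y in (0:ℝ)..(s ⟨0, hn⟩), ∫ x in (0:ℝ)..y,
        ∏ i ∈ univ.filter (fun i => i ≠ (⟨0, hn⟩ : Fin n) ∧ i ≠ k), (1 - x / s i)
      ≤ τ / (p + 1) := by
    intro k
    have hcont : Continuous fun y : ℝ ↦ ∫ x in (0:ℝ)..y,
        ∏ i ∈ univ.filter (fun i => i ≠ (⟨0, hn⟩ : Fin n) ∧ i ≠ k), (1 - x / s i) :=
      intervalIntegral.continuous_primitive
        (fun _ _ ↦ Continuous.intervalIntegrable (by fun_prop) _ _) 0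
    have hle := intervalIntegral.integral_mono_on (hs ⟨0, hn⟩).le
      (hcont.intervalIntegrable _ _)
      (intervalIntegrable_const (μ := volume) (c := τ / ((p : ℝ) + 1))) fun y hy ↦
        integral_prod_one_sub_div_le hs hy.1 (fun i ↦ hy.2.trans (hmin i)) hτ
          (hy.2.trans h0τ) _ (hcard₂ k)
    rw [intervalIntegral.integral_const, sub_zero, smul_eq_mul] at hle
    rw [one_div, inv_mul_le_iff₀ (hs _)]
    exact hle
  have hsum := Finset.sum_le_card_nsmul (univ.filter (fun k => k ≠ (⟨0, hn⟩ : Fin n))) _ _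
    fun k _ ↦ hterm k
  have hcard : ((#(univ.filter (fun k => k ≠ (⟨0, hn⟩ : Fin n))) : ℕ) : ℝ) = n - 1 := by
    rw [Finset.filter_ne', Finset.card_erase_of_mem (Finset.mem_univ _), Finset.card_univ,
      Fintype.card_fin, Nat.cast_sub hn, Nat.cast_one]
  rw [nsmul_eq_mul, hcard] at hsum
  have hfirst := integral_prod_one_sub_div_le hs (hs _).le hmin hτ h0τ _ hcard₁
  have hcast : ((p + 1 : ℕ) : ℝ) + 1 = p + 2 := by push_cast; ring
  rw [hcast] at hfirst
  exact add_le_add hfirst hsum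

end SCM

lemma SCM_le_two_mul {n : ℕ} (hn : 0 < n) (hne : Even n) {s : Fin n → ℝ} (hs : ∀ i, 0 < s i)
    (hmin : ∀ i, s ⟨0, hn⟩ ≤ s i) {τ : ℝ} (hcard : n < 2 * #{i | s i ≤ τ}) :
    SCM s hn ≤ 2 * τ := by
  obtain ⟨m, rfl⟩ := hne
  obtain ⟨q, rfl⟩ : ∃ q, m = q + 1 := ⟨m - 1, by omega⟩
  obtain ⟨j, hj⟩ := Finset.card_pos.1 (by omega : 0 < #{i | s i ≤ τ})
  have hτ : 0 < τ := (hs j).trans_le (Finset.mem_filter.1 hj).2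
  refine (SCM_le hn hs hmin (τ := τ) (p := q) (by omega)).trans ?_
  have h : τ / ((q : ℝ) + 2) ≤ τ / (q + 1) := by gcongr; norm_num
  calc τ / ((q : ℝ) + 2) + (((q + 1 + (q + 1) : ℕ) : ℝ) - 1) * (τ / (q + 1))
      ≤ τ / (q + 1) + (((q + 1 + (q + 1) : ℕ) : ℝ) - 1) * (τ / (q + 1)) := by gcongr
    _ = 2 * τ := by push_cast; field_simp; ring

/-- A weight whose product over the coordinates is at least one as soon as at most half of them
lie below `τ`. -/
noncomputable def tailWeight (τ x : ℝ) : ℝ := if x ≤ τ then 1 / 3 else 3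

lemma tailWeight_pos (τ x : ℝ) : 0 < tailWeight τ x := by
  unfold tailWeight; split_ifs <;> norm_num

lemma one_le_prod_tailWeight {n : ℕ} {t : Fin n → ℝ} {τ : ℝ}
    (hcard : 2 * #{i | t i ≤ τ} ≤ n) : 1 ≤ ∏ i, tailWeight τ (t i) := by
  have hadd := Finset.card_filter_add_card_filter_not (s := (univ : Finset (Fin n)))
    (fun i ↦ t i ≤ τ)
  rw [Finset.card_univ, Fintype.card_fin] at hadd
  unfold tailWeight
  rw [Finset.prod_ite, Finset.prod_const, Finset.prod_const, one_div, inv_pow,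
    ← div_eq_inv_mul, one_le_div (by positivity)]
  exact pow_le_pow_right₀ (by norm_num) (by omega)

lemma tailWeight_eq_indicator (τ : ℝ) :
    tailWeight τ = fun x ↦ 3 - (Set.Iic τ).indicator (fun _ ↦ (8 / 3 : ℝ)) x := by
  ext x
  by_cases hx : x ≤ τ
  · simp [tailWeight, hx]; norm_num
  · simp [tailWeight, hx]

lemma integrable_tailWeight (μ : Measure ℝ) [IsFiniteMeasure μ] (τ : ℝ) :
    Integrable (tailWeight τ) μ := by
  rw [tailWeight_eq_indicator]
  exact (integrable_const _).sub ((integrable_const _).indicator measurableSet_Iic)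

lemma integral_tailWeight (μ : Measure ℝ) [IsProbabilityMeasure μ] (τ : ℝ) :
    ∫ x, tailWeight τ x ∂μ = 3 - 8 / 3 * μ.real (Set.Iic τ) := by
  rw [tailWeight_eq_indicator, integral_sub (integrable_const _)
    ((integrable_const _).indicator measurableSet_Iic),
    integral_indicator_const _ measurableSet_Iic]
  simp [mul_comm]

lemma ae_le_of_measure_Iic_eq_zero {μ : Measure ℝ} {a : ℝ}
    (h : ∀ x < a, μ (Set.Iic x) = 0) : ∀ᵐ x ∂μ, a ≤ x := by
  have hk : ∀ᵐ x ∂μ, ∀ k : ℕ, a - 1 / ((k : ℝ) + 1) < x := by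
    rw [ae_all_iff]
    intro k
    have hpos : 0 < 1 / ((k : ℝ) + 1) := by positivity
    have := h (a - 1 / ((k : ℝ) + 1)) (by linarith)
    rw [ae_iff]
    simpa only [not_lt, Set.Iic] using this
  filter_upwards [hk] with x hx
  by_contra! hlt
  obtain ⟨k, hk⟩ := exists_nat_one_div_lt (sub_pos.2 hlt)
  linarith [hx k]

lemma SCMgen_nonneg {n : ℕ} (hn : 0 < n) {t : Fin n → ℝ} (ht : ∀ i, 0 < t i) :
    0 ≤ SCMgen t hn :=
  SCM_nonneg hn (fun _ ↦ ht _) fun _ ↦ Tuple.monotone_sort t (Fin.mk_le_of_le_val (Nat.zero_le _))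

lemma SCMgen_le_two_mul {n : ℕ} (hn : 0 < n) (hne : Even n) {t : Fin n → ℝ}
    (ht : ∀ i, 0 < t i) {τ : ℝ} (hcard : n < 2 * #{i | t i ≤ τ}) : SCMgen t hn ≤ 2 * τ := by
  refine SCM_le_two_mul hn hne (fun _ ↦ ht _)
    (fun _ ↦ Tuple.monotone_sort t (Fin.mk_le_of_le_val (Nat.zero_le _))) (hcard.trans_eq ?_)
  congr 1
  exact (Finset.card_equiv (Tuple.sort t) (by simp)).symm

theorem average_case_ratio_bound_exponential
    (n : ℕ) (hn4 : 4 ≤ n) (hne : Even n) (tmin lam : ℝ) (htmin : 0 < tmin) (hlam : 0 < lam)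
    (hlt : lam * tmin ≤ Real.log 12)
    (μ : Measure ℝ) [IsProbabilityMeasure μ]
    (hcdf₁ : ∀ x : ℝ, tmin ≤ x → μ (Set.Iic x) = ENNReal.ofReal (1 - Real.exp (-(lam * x))))
    (hcdf₂ : ∀ x : ℝ, x < tmin → μ (Set.Iic x) = 0)
    (hwc : ∀ t : Fin n → ℝ, (∀ i, tmin ≤ t i) →
      SCMgen t (by omega) ≤
        (((n : ℝ) + 1) / 2) * Finset.univ.inf' ⟨⟨0, by omega⟩, Finset.mem_univ _⟩ t) :
    ∫ t : Fin n → ℝ,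
        SCMgen t (by omega) / Finset.univ.inf' ⟨⟨0, by omega⟩, Finset.mem_univ _⟩ t
        ∂(Measure.pi (fun _ : Fin n => μ))
      < 2 * Real.log 12 / (lam * tmin) + 1.33 := by
  have hn : 0 < n := by omega
  set τ := Real.log 12 / lam with hτ
  have hτt : tmin ≤ τ := by rw [hτ, le_div_iff₀ hlam]; linarith
  have hlam0 : lam ≠ 0 := hlam.ne'
  have hμτ : μ.real (Set.Iic τ) = 11 / 12 := by
    have hexp : Real.exp (-(lam * τ)) = 1 / 12 := by
      rw [hτ, mul_div_cancel₀ _ hlam0, Real.exp_neg, Real.exp_log (by norm_num)]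
      norm_num
    rw [measureReal_def, hcdf₁ τ hτt, hexp, ENNReal.toReal_ofReal (by norm_num)]
    norm_num
  have hae : ∀ᵐ t ∂(Measure.pi (fun _ : Fin n => μ)), ∀ i, tmin ≤ t i := by
    rw [ae_all_iff]
    exact fun i ↦ (Measure.tendsto_eval_ae_ae (μ := fun _ : Fin n ↦ μ)).eventually
      (ae_le_of_measure_Iic_eq_zero hcdf₂)
  have hint : Integrable (fun t : Fin n → ℝ ↦ ∏ i, tailWeight τ (t i))
      (Measure.pi (fun _ : Fin n => μ)) :=
    Integrable.fintype_prod (f := fun _ : Fin n ↦ tailWeight τ)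
      fun _ ↦ integrable_tailWeight μ τ
  have hmain : ∫ t : Fin n → ℝ, SCMgen t hn / univ.inf' ⟨⟨0, hn⟩, mem_univ _⟩ t
        ∂(Measure.pi (fun _ : Fin n => μ))
      ≤ ∫ t : Fin n → ℝ, (2 * (τ / tmin) + ((n : ℝ) + 1) / 2 * ∏ i, tailWeight τ (t i))
        ∂(Measure.pi (fun _ : Fin n => μ)) := by
    refine integral_mono_of_nonneg ?_ ((integrable_const _).add (hint.const_mul _)) ?_
    · filter_upwards [hae] with t ht
      have ht0 : ∀ i, 0 < t i := fun i ↦ htmin.trans_le (ht i)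
      exact div_nonneg (SCMgen_nonneg hn ht0)
        (Finset.le_inf' _ _ fun i _ ↦ (ht0 i).le)
    · filter_upwards [hae] with t ht
      have ht0 : ∀ i, 0 < t i := fun i ↦ htmin.trans_le (ht i)
      have hm : tmin ≤ univ.inf' ⟨⟨0, hn⟩, mem_univ _⟩ t := Finset.le_inf' _ _ fun i _ ↦ ht i
      have hm0 := htmin.trans_le hm
      have hτ0 : 0 < τ := htmin.trans_le hτt
      have hw : 0 < ∏ i, tailWeight τ (t i) := Finset.prod_pos fun i _ ↦ tailWeight_pos _ _
      rcases lt_or_ge n (2 * #{i | t i ≤ τ}) with hc | hc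
      · calc SCMgen t hn / univ.inf' ⟨⟨0, hn⟩, mem_univ _⟩ t
            ≤ 2 * τ / tmin :=
              div_le_div₀ (by positivity) (SCMgen_le_two_mul hn hne ht0 hc) htmin hm
          _ = 2 * (τ / tmin) := mul_div_assoc _ _ _
          _ ≤ _ := le_add_of_nonneg_right (by positivity)
      · calc SCMgen t hn / univ.inf' ⟨⟨0, hn⟩, mem_univ _⟩ t
            ≤ ((n : ℝ) + 1) / 2 := (div_le_iff₀ hm0).2 (hwc t ht)
          _ ≤ ((n : ℝ) + 1) / 2 * ∏ i, tailWeight τ (t i) :=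
              le_mul_of_one_le_right (by positivity) (one_le_prod_tailWeight hc)
          _ ≤ _ := le_add_of_nonneg_left (by positivity)
  refine hmain.trans_lt ?_
  rw [integral_add (integrable_const _) (hint.const_mul _), integral_const_mul (μ := Measure.pi (fun _ : Fin n => μ)) (((n : ℝ) + 1) / 2),
    integral_fintype_prod_eq_pow, integral_tailWeight, hμτ]
  have hτeq : 2 * (τ / tmin) = 2 * Real.log 12 / (lam * tmin) := by
    rw [hτ]; field_simp
  have hbern : 1 + (n : ℝ) * (4 / 5) ≤ (9 / 5) ^ n := by
    have := one_add_mul_le_pow (a := (4 / 5 : ℝ)) (by norm_num) n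
    norm_num at this ⊢
    exact this
  have hsmall : ((n : ℝ) + 1) / 2 * (3 - 8 / 3 * (11 / 12)) ^ n < 1.33 := by
    have h59 : (3 - 8 / 3 * (11 / 12) : ℝ) = (9 / 5)⁻¹ := by norm_num
    rw [h59, inv_pow, ← div_eq_mul_inv, div_lt_iff₀ (by positivity)]
    have : (0 : ℝ) ≤ n := n.cast_nonneg
    norm_num
    linarith
  simp only [integral_const, probReal_univ, one_smul, Fintype.card_fin]
  linarith
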